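/- arXiv:1001.4204 — 14 statements merged into one kernel-verified Lean document; each statement's English description precedes it below -/
import Mathlib

section
/- Let k be a field and let g be a 3×3 matrix over k with g₃₃ ≠ 0 and Δ₁₁(g) ≠ 0. Define α₁ = g₃₃·det(g)/Δ₁₁(g)², α₂ = Δ₁₁(g)/g₃₃², U₁₂ = Δ₂₁(g)/Δ₁₁(g), U₂₁ = Δ₁₂(g)/Δ₁₁(g), U₁₃ = g₁₃/g₃₃, U₃₁ = g₃₁/g₃₃, U₂₃ = g₂₃/g₃₃, U₃₂ = g₃₂/g₃₃. Then: g₁₁/g₃₃ = α₁α₂ + α₂U₁₂U₂₁ + U₁₃U₃₁; g₁₂/g₃₃ = α₂U₁₂ + U₁₃U₃₂; g₁₃/g₃₃ = U₁₃; g₂₁/g₃₃ = α₂U₂₁ + U₂₃U₃₁; g₂₂/g₃₃ = α₂ + U₂₃U₃₂; g₂₃/g₃₃ = U₂₃; g₃₁/g₃₃ = U₃₁; g₃₂/g₃₃ = U₃₂. -/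
/-- The `(i,j)`-minor of a `3 × 3` matrix `g`: the determinant of the `2 × 2` matrix
obtained from `g` by deleting row `i` and column `j`. -/
def minor3 {R : Type*} [CommRing R] (g : Matrix (Fin 3) (Fin 3) R) (i j : Fin 3) : R :=
  (g.submatrix i.succAbove j.succAbove).det

/-- Change-of-variables formulas between matrix coordinates `gᵢⱼ` and the big-cell
coordinates `α₁, α₂, Uᵢⱼ` on the wonderful compactification of `PGL₃`. -/
theorem stmt_2 {k : Type*} [Field k] (g : Matrix (Fin 3) (Fin 3) k)
    (hg33 : g 2 2 ≠ 0) (hΔ11 : minor3 g 0 0 ≠ 0)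
    (α₁ α₂ U₁₂ U₂₁ U₁₃ U₃₁ U₂₃ U₃₂ : k)
    (hα₁ : α₁ = g 2 2 * g.det / (minor3 g 0 0) ^ 2)
    (hα₂ : α₂ = minor3 g 0 0 / (g 2 2) ^ 2)
    (hU₁₂ : U₁₂ = minor3 g 1 0 / minor3 g 0 0)
    (hU₂₁ : U₂₁ = minor3 g 0 1 / minor3 g 0 0)
    (hU₁₃ : U₁₃ = g 0 2 / g 2 2)
    (hU₃₁ : U₃₁ = g 2 0 / g 2 2)
    (hU₂₃ : U₂₃ = g 1 2 / g 2 2)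
    (hU₃₂ : U₃₂ = g 2 1 / g 2 2) :
    g 0 0 / g 2 2 = α₁ * α₂ + α₂ * U₁₂ * U₂₁ + U₁₃ * U₃₁ ∧
    g 0 1 / g 2 2 = α₂ * U₁₂ + U₁₃ * U₃₂ ∧
    g 0 2 / g 2 2 = U₁₃ ∧
    g 1 0 / g 2 2 = α₂ * U₂₁ + U₂₃ * U₃₁ ∧
    g 1 1 / g 2 2 = α₂ + U₂₃ * U₃₂ ∧
    g 1 2 / g 2 2 = U₂₃ ∧
    g 2 0 / g 2 2 = U₃₁ ∧
    g 2 1 / g 2 2 = U₃₂ := by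
  have h00 : minor3 g 0 0 = g 1 1 * g 2 2 - g 1 2 * g 2 1 := by
    simp [minor3, Matrix.det_fin_two, Fin.succAbove]
  have h10 : minor3 g 1 0 = g 0 1 * g 2 2 - g 0 2 * g 2 1 := by
    simp [minor3, Matrix.det_fin_two, Fin.succAbove]
  have h01 : minor3 g 0 1 = g 1 0 * g 2 2 - g 1 2 * g 2 0 := by
    simp [minor3, Matrix.det_fin_two, Fin.succAbove]
  have hdet := Matrix.det_fin_three g
  generalize minor3 g 0 0 = D at *
  generalize minor3 g 1 0 = E at *
  generalize minor3 g 0 1 = F at *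
  generalize g.det = d at *
  subst hα₁ hα₂ hU₁₂ hU₂₁ hU₁₃ hU₃₁ hU₂₃ hU₃₂
  refine ⟨?_, ?_, rfl, ?_, ?_, rfl, rfl, rfl⟩
  · field_simp
    rw [hdet, h10, h01, h00]
    ring
  · field_simp
    rw [h10]
    ring
  · field_simp
    rw [h01]
    ring
  · field_simp
    rw [h00]
    ring
end

section
/- Let D be any k-derivation of K such that D(g₁₁) = g₃₃Δ₂₂/Δ₁₁, D(g₁₂) = g₃₃Δ₂₁/Δ₁₁, D(g₂₁) = g₃₃Δ₁₂/Δ₁₁, D(g₂₂) = g₃₃, and D(g_{i,j}) = 0 for all other (i,j). Then D(α₂) = 1, D(α₁) = 0, and D(U_{i,j}) = 0 for all 1 ≤ i ≠ j ≤ 3. (That is, the partial derivative ∂_{α₂} in big-cell coordinates equals (g₃₃/Δ₁₁)·(Δ₂₂∂_{g₁₁} + Δ₁₁∂_{g₂₂} + Δ₂₁∂_{g₁₂} + Δ₁₂∂_{g₂₁}) in matrix coordinates.) -/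
/-- The partial derivative `∂_{α₂}` in big-cell coordinates equals
`(g₃₃/Δ₁₁)·(Δ₂₂∂_{g₁₁} + Δ₁₁∂_{g₂₂} + Δ₂₁∂_{g₁₂} + Δ₁₂∂_{g₂₁})` in matrix coordinates. -/
theorem stmt_5 {k K : Type*} [Field k] [IsAlgClosed k] [CharZero k] [Field K]
    [Algebra (MvPolynomial (Fin 3 × Fin 3) k) K]
    [IsFractionRing (MvPolynomial (Fin 3 × Fin 3) k) K]
    [Algebra k K] [IsScalarTower k (MvPolynomial (Fin 3 × Fin 3) k) K]
    (g : Matrix (Fin 3) (Fin 3) K)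
    (hg : ∀ i j, g i j = algebraMap (MvPolynomial (Fin 3 × Fin 3) k) K (MvPolynomial.X (i, j)))
    (α₁ α₂ U₁₂ U₂₁ U₁₃ U₃₁ U₂₃ U₃₂ : K)
    (hα₁ : α₁ = g 2 2 * g.det / (minor3 g 0 0) ^ 2)
    (hα₂ : α₂ = minor3 g 0 0 / (g 2 2) ^ 2)
    (hU₁₂ : U₁₂ = minor3 g 1 0 / minor3 g 0 0)
    (hU₂₁ : U₂₁ = minor3 g 0 1 / minor3 g 0 0)
    (hU₁₃ : U₁₃ = g 0 2 / g 2 2)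
    (hU₃₁ : U₃₁ = g 2 0 / g 2 2)
    (hU₂₃ : U₂₃ = g 1 2 / g 2 2)
    (hU₃₂ : U₃₂ = g 2 1 / g 2 2)
    (D : Derivation k K K)
    (hD₁₁ : D (g 0 0) = g 2 2 * minor3 g 1 1 / minor3 g 0 0)
    (hD₁₂ : D (g 0 1) = g 2 2 * minor3 g 1 0 / minor3 g 0 0)
    (hD₂₁ : D (g 1 0) = g 2 2 * minor3 g 0 1 / minor3 g 0 0)
    (hD₂₂ : D (g 1 1) = g 2 2)
    (hD : ∀ i j : Fin 3,
      (i, j) ∉ ({(0, 0), (0, 1), (1, 0), (1, 1)} : Set (Fin 3 × Fin 3)) → D (g i j) = 0) :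
    D α₂ = 1 ∧ D α₁ = 0 ∧
    D U₁₂ = 0 ∧ D U₂₁ = 0 ∧ D U₁₃ = 0 ∧ D U₃₁ = 0 ∧ D U₂₃ = 0 ∧ D U₃₂ = 0 := by
  have h02 : D (g 0 2) = 0 := hD 0 2 (by simp)
  have h12 : D (g 1 2) = 0 := hD 1 2 (by simp)
  have h20 : D (g 2 0) = 0 := hD 2 0 (by simp)
  have h21 : D (g 2 1) = 0 := hD 2 1 (by simp)
  have h22 : D (g 2 2) = 0 := hD 2 2 (by simp)
  have inj := IsFractionRing.injective (MvPolynomial (Fin 3 × Fin 3) k) K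
  have e00 : minor3 g 0 0 = g 1 1 * g 2 2 - g 1 2 * g 2 1 := by
    simp [minor3, Matrix.det_fin_two, Fin.succAbove]
  have e10 : minor3 g 1 0 = g 0 1 * g 2 2 - g 0 2 * g 2 1 := by
    simp [minor3, Matrix.det_fin_two, Fin.succAbove]
  have e01 : minor3 g 0 1 = g 1 0 * g 2 2 - g 1 2 * g 2 0 := by
    simp [minor3, Matrix.det_fin_two, Fin.succAbove]
  have e11 : minor3 g 1 1 = g 0 0 * g 2 2 - g 0 2 * g 2 0 := by
    simp [minor3, Matrix.det_fin_two, Fin.succAbove]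
  have hz : g 2 2 ≠ 0 := by
    rw [hg, ne_eq, map_eq_zero_iff _ inj]
    exact MvPolynomial.X_ne_zero _
  have hm : minor3 g 0 0 ≠ 0 := by
    rw [e00, hg, hg, hg, hg, ← map_mul, ← map_mul, ← map_sub, ne_eq, map_eq_zero_iff _ inj]
    intro h
    have := congrArg (MvPolynomial.eval
      (fun p : Fin 3 × Fin 3 => if p.1 = p.2 then (1 : k) else 0)) h
    simp at this
  have d00 : D (minor3 g 0 0) = g 2 2 ^ 2 := by
    rw [e00]; simp [hD₂₂, h12, h21, h22]; ring
  have d10 : D (minor3 g 1 0) = g 2 2 ^ 2 * minor3 g 1 0 / minor3 g 0 0 := by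
    conv_lhs => rw [e10]
    simp [hD₁₂, h02, h21, h22]; ring
  have d01 : D (minor3 g 0 1) = g 2 2 ^ 2 * minor3 g 0 1 / minor3 g 0 0 := by
    conv_lhs => rw [e01]
    simp [hD₂₁, h12, h20, h22]; ring
  have ddet : D g.det = 2 * g.det * g 2 2 ^ 2 / minor3 g 0 0 := by
    rw [Matrix.det_fin_three]
    simp only [map_add, map_sub, Derivation.leibniz, smul_eq_mul, hD₁₁, hD₁₂, hD₂₁, hD₂₂,
      h02, h12, h20, h21, h22]
    field_simp
    rw [e00, e10, e01, e11]
    ring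
  subst hα₁ hα₂ hU₁₂ hU₂₁ hU₁₃ hU₃₁ hU₂₃ hU₃₂
  refine ⟨?_, ?_, ?_, ?_, ?_, ?_, ?_, ?_⟩ <;>
    simp only [Derivation.leibniz_div, Derivation.leibniz, Derivation.leibniz_pow, smul_eq_mul,
      nsmul_eq_mul, d00, d10, d01, ddet, h02, h12, h20, h21, h22] <;>
    field_simp <;> (try push_cast) <;> ring
end

section
/- For each pair (i,j) with 1 ≤ i,j ≤ 3, let d_{ij} be the k-derivation of K determined by d_{ij}(g_{kl}) = 1 if (k,l) = (i,j) and 0 otherwise. Let L := Δ₂₂·d₁₁ + Δ₁₁·d₂₂ + Δ₂₁·d₁₂ + Δ₁₂·d₂₁ (a k-linear endomorphism of K, where f·d denotes the multiplication-by-f operator composed with d). Then the composite ((Δ₁₁/g₃₃)·d₁₁) ∘ ((g₃₃/Δ₁₁)·L) equals d₁₁ ∘ L as k-linear endomorphisms of K. (Hence the second-order operator ∂_{α₁}∂_{α₂} equals ∂_{g₁₁}(Δ₂₂∂_{g₁₁} + Δ₁₁∂_{g₂₂} + Δ₂₁∂_{g₁₂} + Δ₁₂∂_{g₂₁}), which has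 polynomial coefficients; this is the computational content of the theorem that D₀ = ∂_{α₁}∂_{α₂} is a globally defined differential operator on the wonderful compactification of PGL₃.) -/
/-- The second-order operator `∂_{α₁}∂_{α₂} = ((Δ₁₁/g₃₃)∂_{g₁₁}) ∘ ((g₃₃/Δ₁₁)(Δ₂₂∂_{g₁₁} +
Δ₁₁∂_{g₂₂} + Δ₂₁∂_{g₁₂} + Δ₁₂∂_{g₂₁}))` equals
`∂_{g₁₁} ∘ (Δ₂₂∂_{g₁₁} + Δ₁₁∂_{g₂₂} + Δ₂₁∂_{g₁₂} + Δ₁₂∂_{g₂₁})`, which has polynomial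
coefficients: the computational content of the globality of `D₀ = ∂_{α₁}∂_{α₂}` on the
wonderful compactification of `PGL₃`. -/
theorem stmt_6 {k K : Type*} [Field k] [IsAlgClosed k] [CharZero k] [Field K]
    [Algebra (MvPolynomial (Fin 3 × Fin 3) k) K]
    [IsFractionRing (MvPolynomial (Fin 3 × Fin 3) k) K]
    [Algebra k K] [IsScalarTower k (MvPolynomial (Fin 3 × Fin 3) k) K]
    (g : Matrix (Fin 3) (Fin 3) K)
    (hg : ∀ i j, g i j = algebraMap (MvPolynomial (Fin 3 × Fin 3) k) K (MvPolynomial.X (i, j)))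
    (d : Fin 3 → Fin 3 → Derivation k K K)
    (hd : ∀ i j a b : Fin 3, d i j (g a b) = if (a, b) = (i, j) then 1 else 0)
    (L : K →ₗ[k] K)
    (hL : L = minor3 g 1 1 • (d 0 0).toLinearMap + minor3 g 0 0 • (d 1 1).toLinearMap
        + minor3 g 1 0 • (d 0 1).toLinearMap + minor3 g 0 1 • (d 1 0).toLinearMap) :
    ((minor3 g 0 0 / g 2 2) • (d 0 0).toLinearMap) ∘ₗ ((g 2 2 / minor3 g 0 0) • L)
      = (d 0 0).toLinearMap ∘ₗ L := by
  have hm : minor3 g 0 0 = g 1 1 * g 2 2 - g 1 2 * g 2 1 := by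
    simp [minor3, Matrix.det_fin_two]
  have hinj := IsFractionRing.injective (MvPolynomial (Fin 3 × Fin 3) k) K
  have h22 : g 2 2 ≠ 0 := by
    rw [hg]
    exact (map_ne_zero_iff _ hinj).2 (MvPolynomial.X_ne_zero _)
  have hm0 : minor3 g 0 0 ≠ 0 := by
    rw [hm, hg, hg, hg, hg, ← map_mul, ← map_mul, ← map_sub]
    refine (map_ne_zero_iff _ hinj).2 ?_
    intro h
    have h' := congrArg (MvPolynomial.eval
      (fun p : Fin 3 × Fin 3 => if p.1 = p.2 then (1 : k) else 0)) h
    simp at h'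
  have hd22 : d 0 0 (g 2 2) = 0 := by simp [hd]
  have hdm : d 0 0 (minor3 g 0 0) = 0 := by
    rw [hm]
    simp [hd]
  have hdq : d 0 0 (g 2 2 / minor3 g 0 0) = 0 := by
    rw [Derivation.leibniz_div, hd22, hdm]
    simp
  ext x
  simp only [LinearMap.comp_apply, LinearMap.smul_apply, smul_eq_mul, 
    Derivation.coeFn_coe, Derivation.leibniz, hdq]
  field_simp
  simp
end

section
/- Let D be any k-derivation of K such that D(g₁ⱼ) = −g₂ⱼ for j = 1,2,3 and D(g_{i,j}) = 0 for i ≠ 1. Then D(U₁₂) = −1, D(U₁₃) = −U₂₃, and D(α₁) = D(α₂) = D(U₂₁) = D(U₂₃) = D(U₃₁) = D(U₃₂) = 0. (This is the expression of the infinitesimal left action of the root vector X₁ of sl₃ in big-cell coordinates: Φ₀(X₁) = −∂_{U₁₂} − U₂₃∂_{U₁₃}.) -/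
/-- The infinitesimal left action of the root vector `X₁` of `sl₃` in big-cell
coordinates: `Φ₀(X₁) = −∂_{U₁₂} − U₂₃∂_{U₁₃}`. -/
theorem stmt_7 {k K : Type*} [Field k] [IsAlgClosed k] [CharZero k] [Field K]
    [Algebra (MvPolynomial (Fin 3 × Fin 3) k) K]
    [IsFractionRing (MvPolynomial (Fin 3 × Fin 3) k) K]
    [Algebra k K] [IsScalarTower k (MvPolynomial (Fin 3 × Fin 3) k) K]
    (g : Matrix (Fin 3) (Fin 3) K)
    (hg : ∀ i j, g i j = algebraMap (MvPolynomial (Fin 3 × Fin 3) k) K (MvPolynomial.X (i, j)))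
    (α₁ α₂ U₁₂ U₂₁ U₁₃ U₃₁ U₂₃ U₃₂ : K)
    (hα₁ : α₁ = g 2 2 * g.det / (minor3 g 0 0) ^ 2)
    (hα₂ : α₂ = minor3 g 0 0 / (g 2 2) ^ 2)
    (hU₁₂ : U₁₂ = minor3 g 1 0 / minor3 g 0 0)
    (hU₂₁ : U₂₁ = minor3 g 0 1 / minor3 g 0 0)
    (hU₁₃ : U₁₃ = g 0 2 / g 2 2)
    (hU₃₁ : U₃₁ = g 2 0 / g 2 2)
    (hU₂₃ : U₂₃ = g 1 2 / g 2 2)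
    (hU₃₂ : U₃₂ = g 2 1 / g 2 2)
    (D : Derivation k K K)
    (hDX : ∀ j, D (g 0 j) = -(g 1 j))
    (hD : ∀ i j : Fin 3, i ≠ 0 → D (g i j) = 0) :
    D U₁₂ = -1 ∧ D U₁₃ = -U₂₃ ∧
    D α₁ = 0 ∧ D α₂ = 0 ∧ D U₂₁ = 0 ∧ D U₂₃ = 0 ∧ D U₃₁ = 0 ∧ D U₃₂ = 0 := by
  have hm : ∀ i j, minor3 g i j = g (i.succAbove 0) (j.succAbove 0) * g (i.succAbove 1) (j.succAbove 1)
      - g (i.succAbove 0) (j.succAbove 1) * g (i.succAbove 1) (j.succAbove 0) := by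
    intro i j
    simp [minor3, Matrix.det_fin_two]
  have e00 : minor3 g 0 0 = g 1 1 * g 2 2 - g 1 2 * g 2 1 := hm 0 0
  have e10 : minor3 g 1 0 = g 0 1 * g 2 2 - g 0 2 * g 2 1 := hm 1 0
  have e01 : minor3 g 0 1 = g 1 0 * g 2 2 - g 1 2 * g 2 0 := hm 0 1
  have hinj := IsFractionRing.injective (MvPolynomial (Fin 3 × Fin 3) k) K
  have hne : minor3 g 0 0 ≠ 0 := by
    rw [e00]
    simp only [hg, ← map_mul, ← map_sub]
    intro h
    rw [← map_zero (algebraMap (MvPolynomial (Fin 3 × Fin 3) k) K)] at h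
    have h2 := congrArg (MvPolynomial.eval (fun p : Fin 3 × Fin 3 => if p.1 = p.2 then (1 : k) else 0)) (hinj h)
    simp at h2
  have h1 : ∀ j, D (g 1 j) = 0 := fun j => hD 1 j (by decide)
  have h2 : ∀ j, D (g 2 j) = 0 := fun j => hD 2 j (by decide)
  have d00 : D (minor3 g 0 0) = 0 := by
    rw [e00]; simp [Derivation.leibniz, h1, h2]
  have d01 : D (minor3 g 0 1) = 0 := by
    rw [e01]; simp [Derivation.leibniz, h1, h2]
  have d10 : D (minor3 g 1 0) = - minor3 g 0 0 := by
    rw [e10, e00]; simp [Derivation.leibniz, hDX, h2]; ring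
  have dd : D g.det = 0 := by
    rw [Matrix.det_fin_three]; simp [Derivation.leibniz, hDX, h1, h2]; ring
  have h22 : g 2 2 ≠ 0 := by
    rw [hg]
    intro h
    rw [← map_zero (algebraMap (MvPolynomial (Fin 3 × Fin 3) k) K)] at h
    exact MvPolynomial.X_ne_zero _ (hinj h)
  subst hα₁ hα₂ hU₁₂ hU₂₁ hU₁₃ hU₃₁ hU₂₃ hU₃₂
  refine ⟨?_, ?_, ?_, ?_, ?_, ?_, ?_, ?_⟩
  · rw [Derivation.leibniz_div, d00, d10]
    simp only [smul_eq_mul]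
    field_simp
    ring
  · rw [Derivation.leibniz_div, hDX, h2]
    simp only [smul_eq_mul]
    field_simp
    ring
  all_goals simp [Derivation.leibniz_div, Derivation.leibniz, Derivation.leibniz_pow, d00, d01, dd, h1, h2]
end

section
/- Let D be any k-derivation of K such that D(g₂ⱼ) = −g₃ⱼ for j = 1,2,3 and D(g_{i,j}) = 0 for i ≠ 2. Then D(U₂₃) = −1 and D(α₁) = D(α₂) = D(U₁₂) = D(U₁₃) = D(U₂₁) = D(U₃₁) = D(U₃₂) = 0. (This is the expression of the infinitesimal left action of the root vector X₂ of sl₃ in big-cell coordinates: Φ₀(X₂) = −∂_{U₂₃}.) -/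
/-- The infinitesimal left action of the root vector `X₂` of `sl₃` in big-cell
coordinates: `Φ₀(X₂) = −∂_{U₂₃}`. -/
theorem stmt_8 {k K : Type*} [Field k] [IsAlgClosed k] [CharZero k] [Field K]
    [Algebra (MvPolynomial (Fin 3 × Fin 3) k) K]
    [IsFractionRing (MvPolynomial (Fin 3 × Fin 3) k) K]
    [Algebra k K] [IsScalarTower k (MvPolynomial (Fin 3 × Fin 3) k) K]
    (g : Matrix (Fin 3) (Fin 3) K)
    (hg : ∀ i j, g i j = algebraMap (MvPolynomial (Fin 3 × Fin 3) k) K (MvPolynomial.X (i, j)))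
    (α₁ α₂ U₁₂ U₂₁ U₁₃ U₃₁ U₂₃ U₃₂ : K)
    (hα₁ : α₁ = g 2 2 * g.det / (minor3 g 0 0) ^ 2)
    (hα₂ : α₂ = minor3 g 0 0 / (g 2 2) ^ 2)
    (hU₁₂ : U₁₂ = minor3 g 1 0 / minor3 g 0 0)
    (hU₂₁ : U₂₁ = minor3 g 0 1 / minor3 g 0 0)
    (hU₁₃ : U₁₃ = g 0 2 / g 2 2)
    (hU₃₁ : U₃₁ = g 2 0 / g 2 2)
    (hU₂₃ : U₂₃ = g 1 2 / g 2 2)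
    (hU₃₂ : U₃₂ = g 2 1 / g 2 2)
    (D : Derivation k K K)
    (hDX : ∀ j, D (g 1 j) = -(g 2 j))
    (hD : ∀ i j : Fin 3, i ≠ 1 → D (g i j) = 0) :
    D U₂₃ = -1 ∧
    D α₁ = 0 ∧ D α₂ = 0 ∧ D U₁₂ = 0 ∧ D U₁₃ = 0 ∧ D U₂₁ = 0 ∧ D U₃₁ = 0 ∧ D U₃₂ = 0 := by
  have h0 : g 2 2 ≠ 0 := by
    rw [hg]
    intro h
    exact MvPolynomial.X_ne_zero (R := k) ((2, 2) : Fin 3 × Fin 3)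
      ((IsFractionRing.injective (MvPolynomial (Fin 3 × Fin 3) k) K) (by rw [h, map_zero]))
  have hdiv : ∀ a b : K, D a = 0 → D b = 0 → D (a / b) = 0 := by
    intro a b ha hb
    rw [div_eq_mul_inv, Derivation.leibniz, Derivation.leibniz_inv, ha, hb]
    simp
  have hpow : ∀ a : K, D a = 0 → D (a ^ 2) = 0 := by
    intro a ha
    rw [Derivation.leibniz_pow, ha]
    simp
  have d0 : ∀ j, D (g 0 j) = 0 := fun j => hD 0 j (by decide)
  have d2 : ∀ j, D (g 2 j) = 0 := fun j => hD 2 j (by decide)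
  have m00e : minor3 g 0 0 = g 1 1 * g 2 2 - g 1 2 * g 2 1 := by
    rw [minor3, Matrix.det_fin_two]; rfl
  have m10e : minor3 g 1 0 = g 0 1 * g 2 2 - g 0 2 * g 2 1 := by
    rw [minor3, Matrix.det_fin_two]; rfl
  have m01e : minor3 g 0 1 = g 1 0 * g 2 2 - g 1 2 * g 2 0 := by
    rw [minor3, Matrix.det_fin_two]; rfl
  have m00 : D (minor3 g 0 0) = 0 := by
    rw [m00e]
    simp only [map_sub, Derivation.leibniz, hDX, d2, smul_eq_mul]
    ring
  have m10 : D (minor3 g 1 0) = 0 := by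
    rw [m10e]
    simp only [map_sub, Derivation.leibniz, d0, d2, smul_eq_mul]
    ring
  have m01 : D (minor3 g 0 1) = 0 := by
    rw [m01e]
    simp only [map_sub, Derivation.leibniz, hDX, d2, smul_eq_mul]
    ring
  have hdet : D (g 2 2 * g.det) = 0 := by
    rw [Matrix.det_fin_three]
    simp only [map_sub, map_add, Derivation.leibniz, hDX, d0, d2, smul_eq_mul]
    ring
  subst hα₁ hα₂ hU₁₂ hU₂₁ hU₁₃ hU₃₁ hU₂₃ hU₃₂
  refine ⟨?_, hdiv _ _ hdet (hpow _ m00), hdiv _ _ m00 (hpow _ (d2 2)), hdiv _ _ m10 m00,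
    hdiv _ _ (d0 2) (d2 2), hdiv _ _ m01 m00, hdiv _ _ (d2 0) (d2 2), hdiv _ _ (d2 1) (d2 2)⟩
  rw [div_eq_mul_inv, Derivation.leibniz, Derivation.leibniz_inv, d2, hDX]
  simp [h0]
end

section
/- Let D be any k-derivation of K such that D(g₁ⱼ) = −g₃ⱼ for j = 1,2,3 and D(g_{i,j}) = 0 for i ≠ 1. Then D(U₁₃) = −1 and D(α₁) = D(α₂) = D(U₁₂) = D(U₂₁) = D(U₂₃) = D(U₃₁) = D(U₃₂) = 0. (This is the expression of the infinitesimal left action of the root vector X₃ of sl₃ in big-cell coordinates: Φ₀(X₃) = −∂_{U₁₃}.) -/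
/-- The infinitesimal left action of the root vector `X₃` of `sl₃` in big-cell
coordinates: `Φ₀(X₃) = −∂_{U₁₃}`. -/
theorem stmt_9 {k K : Type*} [Field k] [IsAlgClosed k] [CharZero k] [Field K]
    [Algebra (MvPolynomial (Fin 3 × Fin 3) k) K]
    [IsFractionRing (MvPolynomial (Fin 3 × Fin 3) k) K]
    [Algebra k K] [IsScalarTower k (MvPolynomial (Fin 3 × Fin 3) k) K]
    (g : Matrix (Fin 3) (Fin 3) K)
    (hg : ∀ i j, g i j = algebraMap (MvPolynomial (Fin 3 × Fin 3) k) K (MvPolynomial.X (i, j)))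
    (α₁ α₂ U₁₂ U₂₁ U₁₃ U₃₁ U₂₃ U₃₂ : K)
    (hα₁ : α₁ = g 2 2 * g.det / (minor3 g 0 0) ^ 2)
    (hα₂ : α₂ = minor3 g 0 0 / (g 2 2) ^ 2)
    (hU₁₂ : U₁₂ = minor3 g 1 0 / minor3 g 0 0)
    (hU₂₁ : U₂₁ = minor3 g 0 1 / minor3 g 0 0)
    (hU₁₃ : U₁₃ = g 0 2 / g 2 2)
    (hU₃₁ : U₃₁ = g 2 0 / g 2 2)
    (hU₂₃ : U₂₃ = g 1 2 / g 2 2)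
    (hU₃₂ : U₃₂ = g 2 1 / g 2 2)
    (D : Derivation k K K)
    (hDX : ∀ j, D (g 0 j) = -(g 2 j))
    (hD : ∀ i j : Fin 3, i ≠ 0 → D (g i j) = 0) :
    D U₁₃ = -1 ∧
    D α₁ = 0 ∧ D α₂ = 0 ∧ D U₁₂ = 0 ∧ D U₂₁ = 0 ∧ D U₂₃ = 0 ∧ D U₃₁ = 0 ∧ D U₃₂ = 0 := by
  have hne : g 2 2 ≠ 0 := by
    rw [hg]
    intro h
    exact MvPolynomial.X_ne_zero (R := k) ((2, 2) : Fin 3 × Fin 3)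
      ((IsFractionRing.injective (MvPolynomial (Fin 3 × Fin 3) k) K) (by rw [h, map_zero]))
  have hdiv : ∀ a b : K, D a = 0 → D b = 0 → D (a / b) = 0 := by
    intro a b ha hb
    rw [Derivation.leibniz_div, ha, hb]
    simp
  have h1 : ∀ j, D (g 1 j) = 0 := fun j => hD 1 j (by decide)
  have h2 : ∀ j, D (g 2 j) = 0 := fun j => hD 2 j (by decide)
  have hsq : ∀ b : K, D b = 0 → D (b ^ 2) = 0 := by
    intro b hb
    rw [Derivation.leibniz_pow, hb]
    simp
  have m00 : D (minor3 g 0 0) = 0 := by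
    have e : minor3 g 0 0 = g 1 1 * g 2 2 - g 1 2 * g 2 1 := by
      simp [minor3, Matrix.det_fin_two, Fin.succAbove]
    rw [e]
    simp [h1, h2]
  have m10 : D (minor3 g 1 0) = 0 := by
    have e : minor3 g 1 0 = g 0 1 * g 2 2 - g 0 2 * g 2 1 := by
      simp [minor3, Matrix.det_fin_two, Fin.succAbove]
    rw [e]
    simp [h2, hDX]
    ring
  have m01 : D (minor3 g 0 1) = 0 := by
    have e : minor3 g 0 1 = g 1 0 * g 2 2 - g 1 2 * g 2 0 := by
      simp [minor3, Matrix.det_fin_two, Fin.succAbove]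
    rw [e]
    simp [h1, h2]
  have hdet : D g.det = 0 := by
    rw [Matrix.det_fin_three]
    simp [h1, h2, hDX]
    ring
  subst hα₁ hα₂ hU₁₂ hU₂₁ hU₁₃ hU₃₁ hU₂₃ hU₃₂
  refine ⟨?_, hdiv _ _ ?_ (hsq _ m00), hdiv _ _ m00 (hsq _ (h2 2)), hdiv _ _ m10 m00,
    hdiv _ _ m01 m00, hdiv _ _ (h1 2) (h2 2), hdiv _ _ (h2 0) (h2 2), hdiv _ _ (h2 1) (h2 2)⟩
  · rw [Derivation.leibniz_div, hDX, h2]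
    simp only [smul_eq_mul, mul_zero, sub_zero]
    field_simp
  · simp [hdet, h2]
end

section
/- Let D be any k-derivation of K such that D(g₂ⱼ) = −g₁ⱼ for j = 1,2,3 and D(g_{i,j}) = 0 for i ≠ 2. Then D(α₁) = 2U₁₂α₁, D(α₂) = −U₁₂α₂, D(U₁₂) = U₁₂², D(U₂₃) = −U₁₃, D(U₂₁) = −α₁, and D(U₁₃) = D(U₃₁) = D(U₃₂) = 0. (This is the expression of the infinitesimal left action of the root vector Y₁ of sl₃, Φ₀(Y₁) = −g₁₁∂_{g₂₁} − g₁₂∂_{g₂₂} − g₁₃∂_{g₂₃}, in big-cell coordinates.) -/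
/-- The infinitesimal left action of the root vector `Y₁` of `sl₃`,
`Φ₀(Y₁) = −g₁₁∂_{g₂₁} − g₁₂∂_{g₂₂} − g₁₃∂_{g₂₃}`, in big-cell coordinates. -/
theorem stmt_10 {k K : Type*} [Field k] [IsAlgClosed k] [CharZero k] [Field K]
    [Algebra (MvPolynomial (Fin 3 × Fin 3) k) K]
    [IsFractionRing (MvPolynomial (Fin 3 × Fin 3) k) K]
    [Algebra k K] [IsScalarTower k (MvPolynomial (Fin 3 × Fin 3) k) K]
    (g : Matrix (Fin 3) (Fin 3) K)
    (hg : ∀ i j, g i j = algebraMap (MvPolynomial (Fin 3 × Fin 3) k) K (MvPolynomial.X (i, j)))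
    (α₁ α₂ U₁₂ U₂₁ U₁₃ U₃₁ U₂₃ U₃₂ : K)
    (hα₁ : α₁ = g 2 2 * g.det / (minor3 g 0 0) ^ 2)
    (hα₂ : α₂ = minor3 g 0 0 / (g 2 2) ^ 2)
    (hU₁₂ : U₁₂ = minor3 g 1 0 / minor3 g 0 0)
    (hU₂₁ : U₂₁ = minor3 g 0 1 / minor3 g 0 0)
    (hU₁₃ : U₁₃ = g 0 2 / g 2 2)
    (hU₃₁ : U₃₁ = g 2 0 / g 2 2)
    (hU₂₃ : U₂₃ = g 1 2 / g 2 2)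
    (hU₃₂ : U₃₂ = g 2 1 / g 2 2)
    (D : Derivation k K K)
    (hDY : ∀ j, D (g 1 j) = -(g 0 j))
    (hD : ∀ i j : Fin 3, i ≠ 1 → D (g i j) = 0) :
    D α₁ = 2 * U₁₂ * α₁ ∧ D α₂ = -(U₁₂ * α₂) ∧ D U₁₂ = U₁₂ ^ 2 ∧
    D U₂₃ = -U₁₃ ∧ D U₂₁ = -α₁ ∧ D U₁₃ = 0 ∧ D U₃₁ = 0 ∧ D U₃₂ = 0 := by
  have inj := IsFractionRing.injective (MvPolynomial (Fin 3 × Fin 3) k) K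
  have h33 : g 2 2 ≠ 0 := by
    rw [hg]
    intro h
    exact MvPolynomial.X_ne_zero _ ((map_eq_zero_iff _ inj).1 h)
  have e00 : minor3 g 0 0 = g 1 1 * g 2 2 - g 1 2 * g 2 1 := by
    rw [minor3, Matrix.det_fin_two]; rfl
  have e10 : minor3 g 1 0 = g 0 1 * g 2 2 - g 0 2 * g 2 1 := by
    rw [minor3, Matrix.det_fin_two]; rfl
  have e01 : minor3 g 0 1 = g 1 0 * g 2 2 - g 1 2 * g 2 0 := by
    rw [minor3, Matrix.det_fin_two]; rfl
  have h11 : minor3 g 0 0 ≠ 0 := by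
    rw [e00]
    simp only [hg, ← map_mul, ← map_sub]
    intro h
    have h2 := (map_eq_zero_iff _ inj).1 h
    have h3 := congrArg (MvPolynomial.eval
      (fun p : Fin 3 × Fin 3 => if p.1 = p.2 then (1 : k) else 0)) h2
    simp at h3
  have quot : ∀ a b : K, b ≠ 0 → D (a / b) = (b * D a - a * D b) / b ^ 2 := by
    intro a b hb
    have h := D.leibniz (a / b) b
    rw [div_mul_cancel₀ _ hb] at h
    simp only [smul_eq_mul] at h
    rw [h]
    field_simp
    ring
  have d0 : ∀ j, D (g 0 j) = 0 := fun j => hD 0 j (by decide)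
  have d2 : ∀ j, D (g 2 j) = 0 := fun j => hD 2 j (by decide)
  have D00 : D (minor3 g 0 0) = - minor3 g 1 0 := by
    rw [e00, e10]
    simp only [map_sub, Derivation.leibniz, smul_eq_mul, d2, hDY]
    ring
  have D10 : D (minor3 g 1 0) = 0 := by
    rw [e10]
    simp only [map_sub, Derivation.leibniz, smul_eq_mul, d2, d0]
    ring
  have D01 : D (minor3 g 0 1) = - (g 0 0 * g 2 2 - g 0 2 * g 2 0) := by
    rw [e01]
    simp only [map_sub, Derivation.leibniz, smul_eq_mul, d2, hDY]
    ring
  have Ddet : D g.det = 0 := by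
    rw [Matrix.det_fin_three]
    simp only [map_sub, map_add, Derivation.leibniz, smul_eq_mul, d0, d2, hDY]
    ring
  have Dsq : ∀ a : K, D (a ^ 2) = 2 * a * D a := by
    intro a
    rw [pow_two, Derivation.leibniz, smul_eq_mul]
    ring
  subst hα₁ hα₂ hU₁₂ hU₂₁ hU₁₃ hU₃₁ hU₂₃ hU₃₂
  refine ⟨?_, ?_, ?_, ?_, ?_, ?_, ?_, ?_⟩
  · rw [quot _ _ (pow_ne_zero 2 h11), Dsq, D00, Derivation.leibniz, Ddet, d2]
    simp only [smul_eq_mul]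
    field_simp
    ring
  · rw [quot _ _ (pow_ne_zero 2 h33), Dsq, D00, d2]
    field_simp
    ring
  · rw [quot _ _ h11, D00, D10]
    field_simp
    ring
  · rw [quot _ _ h33, hDY, d2]
    field_simp
    ring
  · rw [quot _ _ h11, D00, D01, ← neg_div]
    congr 1
    rw [Matrix.det_fin_three, e00, e01, e10]
    ring
  · rw [quot _ _ h33, d0, d2]
    simp
  · rw [quot _ _ h33, d2, d2]
    simp
  · rw [quot _ _ h33, d2, d2]
    simp
end

section
/- Let D be any k-derivation of K such that D(g₃ⱼ) = −g₂ⱼ for j = 1,2,3 and D(g_{i,j}) = 0 for i ≠ 3. Then D(α₁) = −U₂₃α₁, D(α₂) = 2U₂₃α₂, D(U₁₂) = U₁₃ − U₁₂U₂₃, D(U₂₃) = U₂₃², D(U₁₃) = U₁₃U₂₃, D(U₃₁) = −α₂U₂₁, D(U₃₂) = −α₂, and D(U₂₁) = 0. (This is the expression of the infinitesimal left action of the root vector Y₂ of sl₃, Φ₀(Y₂) = −g₂₁∂_{g₃₁} − g₂₂∂_{g₃₂} − g₂₃∂_{g₃₃}, in big-cell coordinates.) -/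
/-- The infinitesimal left action of the root vector `Y₂` of `sl₃`,
`Φ₀(Y₂) = −g₂₁∂_{g₃₁} − g₂₂∂_{g₃₂} − g₂₃∂_{g₃₃}`, in big-cell coordinates. -/
theorem stmt_11 {k K : Type*} [Field k] [IsAlgClosed k] [CharZero k] [Field K]
    [Algebra (MvPolynomial (Fin 3 × Fin 3) k) K]
    [IsFractionRing (MvPolynomial (Fin 3 × Fin 3) k) K]
    [Algebra k K] [IsScalarTower k (MvPolynomial (Fin 3 × Fin 3) k) K]
    (g : Matrix (Fin 3) (Fin 3) K)
    (hg : ∀ i j, g i j = algebraMap (MvPolynomial (Fin 3 × Fin 3) k) K (MvPolynomial.X (i, j)))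
    (α₁ α₂ U₁₂ U₂₁ U₁₃ U₃₁ U₂₃ U₃₂ : K)
    (hα₁ : α₁ = g 2 2 * g.det / (minor3 g 0 0) ^ 2)
    (hα₂ : α₂ = minor3 g 0 0 / (g 2 2) ^ 2)
    (hU₁₂ : U₁₂ = minor3 g 1 0 / minor3 g 0 0)
    (hU₂₁ : U₂₁ = minor3 g 0 1 / minor3 g 0 0)
    (hU₁₃ : U₁₃ = g 0 2 / g 2 2)
    (hU₃₁ : U₃₁ = g 2 0 / g 2 2)
    (hU₂₃ : U₂₃ = g 1 2 / g 2 2)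
    (hU₃₂ : U₃₂ = g 2 1 / g 2 2)
    (D : Derivation k K K)
    (hDY : ∀ j, D (g 2 j) = -(g 1 j))
    (hD : ∀ i j : Fin 3, i ≠ 2 → D (g i j) = 0) :
    D α₁ = -(U₂₃ * α₁) ∧ D α₂ = 2 * U₂₃ * α₂ ∧ D U₁₂ = U₁₃ - U₁₂ * U₂₃ ∧
    D U₂₃ = U₂₃ ^ 2 ∧ D U₁₃ = U₁₃ * U₂₃ ∧ D U₃₁ = -(α₂ * U₂₁) ∧ D U₃₂ = -α₂ ∧
    D U₂₁ = 0 := by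
  have inj := IsFractionRing.injective (MvPolynomial (Fin 3 × Fin 3) k) K
  have h22 : g 2 2 ≠ 0 := by
    rw [hg]
    intro h
    exact MvPolynomial.X_ne_zero (R := k) ((2, 2) : Fin 3 × Fin 3)
      (inj (h.trans (map_zero _).symm))
  have e00 : minor3 g 0 0 = g 1 1 * g 2 2 - g 1 2 * g 2 1 := by
    simp [minor3, Matrix.det_fin_two, Fin.succAbove]
  have e10 : minor3 g 1 0 = g 0 1 * g 2 2 - g 0 2 * g 2 1 := by
    simp [minor3, Matrix.det_fin_two, Fin.succAbove]
  have e01 : minor3 g 0 1 = g 1 0 * g 2 2 - g 1 2 * g 2 0 := by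
    simp [minor3, Matrix.det_fin_two, Fin.succAbove]
  have hm : minor3 g 0 0 ≠ 0 := by
    rw [e00, hg, hg, hg, hg, ← map_mul, ← map_mul, ← map_sub]
    intro h
    have h2 := inj (h.trans (map_zero _).symm)
    have h3 := congrArg (MvPolynomial.eval
      (fun p : Fin 3 × Fin 3 => if p.1 = p.2 then (1 : k) else 0)) h2
    simp at h3
  have a0 := hDY 0
  have a1 := hDY 1
  have a2 := hDY 2
  have b00 := hD 0 0 (by decide)
  have b01 := hD 0 1 (by decide)
  have b02 := hD 0 2 (by decide)
  have b10 := hD 1 0 (by decide)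
  have b11 := hD 1 1 (by decide)
  have b12 := hD 1 2 (by decide)
  have d00 : D (minor3 g 0 0) = 0 := by
    rw [e00]
    simp only [map_sub, Derivation.leibniz, smul_eq_mul, a1, a2, b11, b12]
    ring
  have d01 : D (minor3 g 0 1) = 0 := by
    rw [e01]
    simp only [map_sub, Derivation.leibniz, smul_eq_mul, a0, a2, b10, b12]
    ring
  have d10 : D (minor3 g 1 0) = g 0 2 * g 1 1 - g 0 1 * g 1 2 := by
    rw [e10]
    simp only [map_sub, Derivation.leibniz, smul_eq_mul, a1, a2, b01, b02]
    ring
  have dd : D g.det = 0 := by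
    rw [Matrix.det_fin_three]
    simp only [map_sub, map_add, Derivation.leibniz, smul_eq_mul, a0, a1, a2, b00, b01, b02,
      b10, b11, b12]
    ring
  have q : ∀ a b : K, D (a / b) = (b * D a - a * D b) / b ^ 2 := by
    intro a b
    rw [Derivation.leibniz_div]
    simp only [smul_eq_mul]
    ring
  subst hα₁ hα₂ hU₁₂ hU₂₁ hU₁₃ hU₃₁ hU₂₃ hU₃₂
  refine ⟨?_, ?_, ?_, ?_, ?_, ?_, ?_, ?_⟩
  · simp only [q, pow_two, Derivation.leibniz, smul_eq_mul, d00, dd, a2]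
    field_simp
    ring
  · simp only [q, pow_two, Derivation.leibniz, smul_eq_mul, d00, a2]
    field_simp
    ring
  · rw [q, d10, d00]
    field_simp
    rw [e10, e00]
    ring
  · rw [q, a2, b12]
    field_simp
    ring
  · rw [q, a2, b02]
    field_simp
    ring
  · rw [q, a2, a0]
    field_simp
    rw [e01]
    ring
  · rw [q, a2, a1]
    field_simp
    rw [e00]
    ring
  · rw [q, d01, d00]
    simp
end

section
/- Let D be any k-derivation of K such that D(g₃ⱼ) = −g₁ⱼ for j = 1,2,3 and D(g_{i,j}) = 0 for i ≠ 3. Then D(α₁) = (U₁₃ − 2U₁₂U₂₃)α₁, D(α₂) = (U₁₃ + U₁₂U₂₃)α₂, D(U₁₂) = (U₁₃ − U₁₂U₂₃)U₁₂, D(U₂₃) = U₁₃U₂₃, D(U₁₃) = U₁₃², D(U₂₁) = α₁U₂₃, D(U₃₂) = −α₂U₁₂, and D(U₃₁) = −α₂U₁₂U₂₁ − α₁α₂. (This is the expression of the infinitesimal left action of the root vector Y₃ of sl₃, Φ₀(Y₃) = −g₁₁∂_{g₃₁} − g₁₂∂_{g₃₂} − g₁₃∂_{g₃₃}, in big-cell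 coordinates.) -/
/-- The infinitesimal left action of the root vector `Y₃` of `sl₃`,
`Φ₀(Y₃) = −g₁₁∂_{g₃₁} − g₁₂∂_{g₃₂} − g₁₃∂_{g₃₃}`, in big-cell coordinates. -/
theorem stmt_12 {k K : Type*} [Field k] [IsAlgClosed k] [CharZero k] [Field K]
    [Algebra (MvPolynomial (Fin 3 × Fin 3) k) K]
    [IsFractionRing (MvPolynomial (Fin 3 × Fin 3) k) K]
    [Algebra k K] [IsScalarTower k (MvPolynomial (Fin 3 × Fin 3) k) K]
    (g : Matrix (Fin 3) (Fin 3) K)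
    (hg : ∀ i j, g i j = algebraMap (MvPolynomial (Fin 3 × Fin 3) k) K (MvPolynomial.X (i, j)))
    (α₁ α₂ U₁₂ U₂₁ U₁₃ U₃₁ U₂₃ U₃₂ : K)
    (hα₁ : α₁ = g 2 2 * g.det / (minor3 g 0 0) ^ 2)
    (hα₂ : α₂ = minor3 g 0 0 / (g 2 2) ^ 2)
    (hU₁₂ : U₁₂ = minor3 g 1 0 / minor3 g 0 0)
    (hU₂₁ : U₂₁ = minor3 g 0 1 / minor3 g 0 0)
    (hU₁₃ : U₁₃ = g 0 2 / g 2 2)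
    (hU₃₁ : U₃₁ = g 2 0 / g 2 2)
    (hU₂₃ : U₂₃ = g 1 2 / g 2 2)
    (hU₃₂ : U₃₂ = g 2 1 / g 2 2)
    (D : Derivation k K K)
    (hDY : ∀ j, D (g 2 j) = -(g 0 j))
    (hD : ∀ i j : Fin 3, i ≠ 2 → D (g i j) = 0) :
    D α₁ = (U₁₃ - 2 * U₁₂ * U₂₃) * α₁ ∧ D α₂ = (U₁₃ + U₁₂ * U₂₃) * α₂ ∧
    D U₁₂ = (U₁₃ - U₁₂ * U₂₃) * U₁₂ ∧ D U₂₃ = U₁₃ * U₂₃ ∧ D U₁₃ = U₁₃ ^ 2 ∧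
    D U₂₁ = α₁ * U₂₃ ∧ D U₃₂ = -(α₂ * U₁₂) ∧ D U₃₁ = -(α₂ * U₁₂ * U₂₁) - α₁ * α₂ := by
  have hinj : Function.Injective (algebraMap (MvPolynomial (Fin 3 × Fin 3) k) K) :=
    IsFractionRing.injective _ _
  have h00 : minor3 g 0 0 = g 1 1 * g 2 2 - g 1 2 * g 2 1 := by
    simp [minor3, Matrix.det_fin_two, Fin.succAbove, Fin.lt_def]
  have h10 : minor3 g 1 0 = g 0 1 * g 2 2 - g 0 2 * g 2 1 := by
    simp [minor3, Matrix.det_fin_two, Fin.succAbove, Fin.lt_def]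
  have h01 : minor3 g 0 1 = g 1 0 * g 2 2 - g 1 2 * g 2 0 := by
    simp [minor3, Matrix.det_fin_two, Fin.succAbove, Fin.lt_def]
  have hc : g 2 2 ≠ 0 := by
    rw [hg, Ne, map_eq_zero_iff _ hinj]
    exact MvPolynomial.X_ne_zero _
  have hm : g 1 1 * g 2 2 - g 1 2 * g 2 1 ≠ 0 := by
    simp only [hg, ← map_mul, ← map_sub]
    rw [Ne, map_eq_zero_iff _ hinj]
    intro h
    have := congrArg (MvPolynomial.eval (fun p : Fin 3 × Fin 3 => if p.1 = p.2 then (1 : k) else 0)) h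
    simp at this
  have hdiv : ∀ a b : K, b ≠ 0 → D (a / b) = (b * D a - a * D b) / b ^ 2 := by
    intro a b hb
    have h : D (a / b * b) = D a := by rw [div_mul_cancel₀ _ hb]
    rw [D.leibniz, smul_eq_mul, smul_eq_mul] at h
    rw [← h]
    field_simp
    ring
  rw [h00, Matrix.det_fin_three] at hα₁
  rw [h00] at hα₂
  rw [h10, h00] at hU₁₂
  rw [h01, h00] at hU₂₁
  have d0 := fun j => hD 0 j (by decide)
  have d1 := fun j => hD 1 j (by decide)
  have hc2 := pow_ne_zero 2 hc
  have hm2 := pow_ne_zero 2 hm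
  clear hD hg h00 h10 h01
  subst hα₁ hα₂ hU₁₂ hU₂₁ hU₁₃ hU₃₁ hU₂₃ hU₃₂
  rw [hdiv _ _ hm2, hdiv _ _ hc2, hdiv _ _ hm, hdiv _ _ hm, hdiv _ _ hc, hdiv _ _ hc,
    hdiv _ _ hc, hdiv _ _ hc]
  simp only [pow_two, map_sub, map_add, D.leibniz, smul_eq_mul, d0, d1, hDY]
  generalize g 0 0 = a at *
  generalize g 0 1 = b at *
  generalize g 0 2 = c at *
  generalize g 1 0 = d at *
  generalize g 1 1 = e at *
  generalize g 1 2 = f at *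
  generalize g 2 0 = x at *
  generalize g 2 1 = y at *
  generalize g 2 2 = z at *
  clear hdiv hDY d0 d1 hm2
  obtain ⟨m, hmm⟩ : ∃ m, m = e * z - f * y := ⟨_, rfl⟩
  rw [← hmm] at hm ⊢
  refine ⟨?_, ?_, ?_, ?_, ?_, ?_, ?_, ?_⟩ <;> field_simp <;> (try subst hmm) <;> ring
end

section
/- In the ring of k-linear endomorphisms of R, define: h₁ := −Σⱼ g₁ⱼp₁ⱼ + Σⱼ g₂ⱼp₂ⱼ, h₂ := −Σⱼ g₂ⱼp₂ⱼ + Σⱼ g₃ⱼp₃ⱼ, y₁ := −Σⱼ g₁ⱼp₂ⱼ, y₂ := −Σⱼ g₂ⱼp₃ⱼ, y₃ := −Σⱼ g₁ⱼp₃ⱼ, x₁ := −Σⱼ g₂ⱼp₁ⱼ, x₂ := −Σⱼ g₃ⱼp₂ⱼ, x₃ := −Σⱼ g₃ⱼp₁ⱼ (sums over j = 1,2,3, where g_{ij}· denotes multiplication by the variable and p_{ij} the partial derivative ∂/∂g_{ij}), and let C := (1/3)(h₁ + h₂) + (1/9)(h₁∘h₁ + h₂∘h₂ + h₁∘h₂)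 + (1/3)(y₁∘x₁ + y₂∘x₂ + y₃∘x₃). Let D₀ := p₁₁ ∘ (Δ₂₂p₁₁ + Δ₁₁p₂₂ + Δ₂₁p₁₂ + Δ₁₂p₂₁). Then D₀ ∘ C ≠ C ∘ D₀. (Thus the global differential operator D₀ does not commute with the image of the standard Casimir element of U(sl₃ × 0), so D₀ is not the image of an element of U(sl₃ × sl₃).) -/
open MvPolynomial

/-- The global differential operator `D₀ = ∂_{g₁₁}(Δ₂₂∂_{g₁₁} + Δ₁₁∂_{g₂₂} + Δ₂₁∂_{g₁₂} +
Δ₁₂∂_{g₂₁})` does not commute with the image `C` of the standard Casimir element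
`c = (1/3)(H₁+H₂) + (1/9)(H₁²+H₂²+H₁H₂) + (1/3)(Y₁X₁+Y₂X₂+Y₃X₃)` of `U(sl₃ × 0)`;
hence `D₀` is not the image of an element of `U(sl₃ × sl₃)`. -/
theorem stmt_13 {k : Type*} [Field k] [CharZero k]
    (p : Fin 3 → Fin 3 →
      (MvPolynomial (Fin 3 × Fin 3) k →ₗ[k] MvPolynomial (Fin 3 × Fin 3) k))
    (hp : ∀ i j, p i j = (pderiv (i, j)).toLinearMap)
    (h₁ h₂ y₁ y₂ y₃ x₁ x₂ x₃ C D₀ :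
      MvPolynomial (Fin 3 × Fin 3) k →ₗ[k] MvPolynomial (Fin 3 × Fin 3) k)
    (hh₁ : h₁ = -(∑ j, (X ((0 : Fin 3), j) : MvPolynomial (Fin 3 × Fin 3) k) • p 0 j) + ∑ j, (X ((1 : Fin 3), j) : MvPolynomial (Fin 3 × Fin 3) k) • p 1 j)
    (hh₂ : h₂ = -(∑ j, (X ((1 : Fin 3), j) : MvPolynomial (Fin 3 × Fin 3) k) • p 1 j) + ∑ j, (X ((2 : Fin 3), j) : MvPolynomial (Fin 3 × Fin 3) k) • p 2 j)
    (hy₁ : y₁ = -(∑ j, (X ((0 : Fin 3), j) : MvPolynomial (Fin 3 × Fin 3) k) • p 1 j))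
    (hy₂ : y₂ = -(∑ j, (X ((1 : Fin 3), j) : MvPolynomial (Fin 3 × Fin 3) k) • p 2 j))
    (hy₃ : y₃ = -(∑ j, (X ((0 : Fin 3), j) : MvPolynomial (Fin 3 × Fin 3) k) • p 2 j))
    (hx₁ : x₁ = -(∑ j, (X ((1 : Fin 3), j) : MvPolynomial (Fin 3 × Fin 3) k) • p 0 j))
    (hx₂ : x₂ = -(∑ j, (X ((2 : Fin 3), j) : MvPolynomial (Fin 3 × Fin 3) k) • p 1 j))
    (hx₃ : x₃ = -(∑ j, (X ((2 : Fin 3), j) : MvPolynomial (Fin 3 × Fin 3) k) • p 0 j))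
    (hC : C = (3 : k)⁻¹ • (h₁ + h₂)
        + (9 : k)⁻¹ • (h₁ ∘ₗ h₁ + h₂ ∘ₗ h₂ + h₁ ∘ₗ h₂)
        + (3 : k)⁻¹ • (y₁ ∘ₗ x₁ + y₂ ∘ₗ x₂ + y₃ ∘ₗ x₃))
    (Δ : Fin 3 → Fin 3 → MvPolynomial (Fin 3 × Fin 3) k)
    (hΔ : ∀ i j, Δ i j = minor3 (Matrix.of fun a b => X (a, b)) i j)
    (hD₀ : D₀ = p 0 0 ∘ₗ
        (Δ 1 1 • p 0 0 + Δ 0 0 • p 1 1 + Δ 1 0 • p 0 1 + Δ 0 1 • p 1 0)) :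
    D₀ ∘ₗ C ≠ C ∘ₗ D₀ := by
  intro h
  have hD : D₀ (X (0, 2) * X (2, 0)) = 0 := by
    simp [hD₀, hp, pderiv_X, Pi.single_apply]
  have hCf : C (X (0, 2) * X (2, 0)) =
      (7 / 9 : k) • (X (0, 2) * X (2, 0)) + (3 : k)⁻¹ • (X (0, 0) * X (2, 2)) := by
    simp only [hC, hh₁, hh₂, hy₁, hy₂, hy₃, hx₁, hx₂, hx₃, hp]
    simp [Fin.sum_univ_three, pderiv_X, Pi.single_apply, smul_eq_C_mul]
    have e3 : (MvPolynomial.C (3 : k)⁻¹ : MvPolynomial (Fin 3 × Fin 3) k)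
        = 3 * MvPolynomial.C (9 : k)⁻¹ := by
      rw [show (3 : k)⁻¹ = 3 * 9⁻¹ by norm_num, map_mul, map_ofNat MvPolynomial.C]
    have e7 : (MvPolynomial.C (7 / 9 : k) : MvPolynomial (Fin 3 × Fin 3) k)
        = 7 * MvPolynomial.C (9 : k)⁻¹ := by
      rw [show (7 / 9 : k) = 7 * 9⁻¹ by norm_num, map_mul, map_ofNat MvPolynomial.C]
    rw [e3, e7]
    ring
  have hD2 : D₀ (X (0, 0) * X (2, 2)) = X (2, 2) * X (2, 2) := by
    simp [hD₀, hp, hΔ, minor3, Matrix.det_fin_two, pderiv_X, Pi.single_apply, Fin.succAbove]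
  have h' := LinearMap.congr_fun h (X (0, 2) * X (2, 0))
  rw [LinearMap.comp_apply, LinearMap.comp_apply, hD, hCf, map_add, map_smul, map_smul, hD, hD2,
    map_zero] at h'
  have h2 := congrArg (eval (fun _ => (1 : k))) h'
  simp [smul_eval] at h2
end

section
/- Let k be a field, u an upper unitriangular 3×3 matrix over k, and x, y ∈ k. Set S := ᵀ(u⁻¹)·diag(1, x, xy)·u⁻¹ and S' := u·diag(xy, y, 1)·ᵀu. Then S and S' are symmetric, S·S' = xy·I₃, adj(S) = x·S', adj(S') = y·S, S₁₁ = 1, and S'₃₃ = 1. -/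
open Matrix

/-- Parametrization of the big cell of the variety of complete conics: for `u` upper
unitriangular and `x, y ∈ k`, the pair `S := ᵀ(u⁻¹)·diag(1,x,xy)·u⁻¹`,
`S' := u·diag(xy,y,1)·ᵀu` consists of symmetric matrices with `S·S' = xy·I₃`,
`adj(S) = x·S'`, `adj(S') = y·S`, `S₁₁ = 1` and `S'₃₃ = 1`. -/
theorem stmt_14 {k : Type*} [Field k] (u₁₂ u₁₃ u₂₃ x y : k)
    (u S S' : Matrix (Fin 3) (Fin 3) k)
    (hu : u = !![1, u₁₂, u₁₃; 0, 1, u₂₃; 0, 0, 1])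
    (hS : S = (u⁻¹)ᵀ * diagonal ![1, x, x * y] * u⁻¹)
    (hS' : S' = u * diagonal ![x * y, y, 1] * uᵀ) :
    S.IsSymm ∧ S'.IsSymm ∧
    S * S' = (x * y) • (1 : Matrix (Fin 3) (Fin 3) k) ∧
    S.adjugate = x • S' ∧ S'.adjugate = y • S ∧
    S 0 0 = 1 ∧ S' 2 2 = 1 := by
  have hinv : u⁻¹ = !![1, -u₁₂, u₁₂ * u₂₃ - u₁₃; 0, 1, -u₂₃; 0, 0, 1] := by
    apply Matrix.inv_eq_right_inv
    subst hu
    ext i j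
    fin_cases i <;> fin_cases j <;> simp [Matrix.mul_apply, Fin.sum_univ_three] <;> ring
  have h1 : S = !![1, -u₁₂, u₁₂ * u₂₃ - u₁₃;
      -u₁₂, u₁₂ ^ 2 + x, -u₁₂ * (u₁₂ * u₂₃ - u₁₃) - x * u₂₃;
      u₁₂ * u₂₃ - u₁₃, -u₁₂ * (u₁₂ * u₂₃ - u₁₃) - x * u₂₃,
      (u₁₂ * u₂₃ - u₁₃) ^ 2 + x * u₂₃ ^ 2 + x * y] := by
    rw [hS, hinv]
    ext i j
    fin_cases i <;> fin_cases j <;>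
      simp [Matrix.mul_apply, Fin.sum_univ_three, Matrix.diagonal_apply] <;> ring
  have h2 : S' = !![x * y + u₁₂ ^ 2 * y + u₁₃ ^ 2, u₁₂ * y + u₁₃ * u₂₃, u₁₃;
      u₁₂ * y + u₁₃ * u₂₃, y + u₂₃ ^ 2, u₂₃; u₁₃, u₂₃, 1] := by
    rw [hS', hu]
    ext i j
    fin_cases i <;> fin_cases j <;>
      simp [Matrix.mul_apply, Fin.sum_univ_three, Matrix.vecMul_diagonal] <;> ring
  clear hS hS' hinv hu
  subst h1 h2
  refine ⟨?_, ?_, ?_, ?_, ?_, ?_, ?_⟩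
  · ext i j
    fin_cases i <;> fin_cases j <;> simp
  · ext i j
    fin_cases i <;> fin_cases j <;> simp
  · ext i j
    fin_cases i <;> fin_cases j <;> simp [Matrix.mul_apply, Fin.sum_univ_three] <;> ring
  · rw [Matrix.adjugate_fin_three]
    ext i j
    fin_cases i <;> fin_cases j <;> simp <;> ring
  · rw [Matrix.adjugate_fin_three]
    ext i j
    fin_cases i <;> fin_cases j <;> simp <;> ring
  · simp
  · simp
end

section
/- Let k be an algebraically closed field of characteristic zero. The map sending (u, x, y), where u ranges over upper unitriangular 3×3 matrices over k and x, y ∈ k, to the pair (S, S') := (ᵀ(u⁻¹)·diag(1, x, xy)·u⁻¹, u·diag(xy, y, 1)·ᵀu), is a bijection from U × k² onto the set of pairs (S, S') of symmetric 3×3 matrices over k such that S·S' is a scalar multiple of I₃, S₁₁ = 1, and S'₃₃ = 1. -/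
open Matrix

/-- The set of upper unitriangular `3 × 3` matrices over `k`. -/
def UpperUnitri (k : Type*) [Field k] : Set (Matrix (Fin 3) (Fin 3) k) :=
  {u | u 0 0 = 1 ∧ u 1 1 = 1 ∧ u 2 2 = 1 ∧ u 1 0 = 0 ∧ u 2 0 = 0 ∧ u 2 1 = 0}

/-- Explicit form of the pair attached to a unitriangular matrix. -/
theorem pair_formula {k : Type*} [Field k] (a b g x y : k) :
    ((((!![1, a, b; 0, 1, g; 0, 0, 1] : Matrix (Fin 3) (Fin 3) k)⁻¹)ᵀ
      * diagonal ![1, x, x * y] * (!![1, a, b; 0, 1, g; 0, 0, 1])⁻¹,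
      !![1, a, b; 0, 1, g; 0, 0, 1] * diagonal ![x * y, y, 1]
        * (!![1, a, b; 0, 1, g; 0, 0, 1])ᵀ) :
      Matrix (Fin 3) (Fin 3) k × Matrix (Fin 3) (Fin 3) k) =
    (!![1, -a, a * g - b; -a, a ^ 2 + x, -a * (a * g - b) - x * g;
        a * g - b, -a * (a * g - b) - x * g, (a * g - b) ^ 2 + x * g ^ 2 + x * y],
     !![x * y + a ^ 2 * y + b ^ 2, a * y + b * g, b; a * y + b * g, y + g ^ 2, g; b, g, 1]) := by
  have hinv : (!![1, a, b; 0, 1, g; 0, 0, 1] : Matrix (Fin 3) (Fin 3) k)⁻¹ =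
      !![1, -a, a * g - b; 0, 1, -g; 0, 0, 1] := by
    apply Matrix.inv_eq_right_inv
    ext i j
    fin_cases i <;> fin_cases j <;> simp [Matrix.mul_apply, Fin.sum_univ_three] <;> ring
  rw [hinv]
  refine Prod.ext ?_ ?_
  · ext i j
    fin_cases i <;> fin_cases j <;>
      simp [Matrix.mul_apply, Fin.sum_univ_three, Matrix.diagonal_apply, Matrix.vecMul_diagonal, vecHead, vecTail] <;> ring
  · ext i j
    fin_cases i <;> fin_cases j <;>
      simp [Matrix.mul_apply, Fin.sum_univ_three, Matrix.diagonal_apply, Matrix.vecMul_diagonal, vecHead, vecTail] <;> ring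

theorem unitri_eq {k : Type*} [Field k] {u : Matrix (Fin 3) (Fin 3) k}
    (hu : u ∈ UpperUnitri k) : ∃ a b g : k, u = !![1, a, b; 0, 1, g; 0, 0, 1] := by
  obtain ⟨h1, h2, h3, h4, h5, h6⟩ := hu
  refine ⟨u 0 1, u 0 2, u 1 2, ?_⟩
  ext i j
  fin_cases i <;> fin_cases j <;> simp [*]

/-- The map `(u, x, y) ↦ (S, S') := (ᵀ(u⁻¹)·diag(1,x,xy)·u⁻¹, u·diag(xy,y,1)·ᵀu)` is a
bijection from `U × k²` onto the set of pairs `(S, S')` of symmetric `3 × 3` matrices with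
`S·S'` a scalar multiple of `I₃`, `S₁₁ = 1` and `S'₃₃ = 1` (the big cell of the variety of
complete conics). -/
theorem stmt_15 {k : Type*} [Field k] [IsAlgClosed k] [CharZero k] :
    Set.BijOn
      (fun t : Matrix (Fin 3) (Fin 3) k × k × k =>
        (((t.1⁻¹)ᵀ * diagonal ![1, t.2.1, t.2.1 * t.2.2] * t.1⁻¹,
          t.1 * diagonal ![t.2.1 * t.2.2, t.2.2, 1] * t.1ᵀ) :
          Matrix (Fin 3) (Fin 3) k × Matrix (Fin 3) (Fin 3) k))
      (UpperUnitri k ×ˢ (Set.univ : Set (k × k)))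
      {p : Matrix (Fin 3) (Fin 3) k × Matrix (Fin 3) (Fin 3) k |
        p.1.IsSymm ∧ p.2.IsSymm ∧ (∃ c : k, p.1 * p.2 = c • (1 : Matrix (Fin 3) (Fin 3) k)) ∧
        p.1 0 0 = 1 ∧ p.2 2 2 = 1} := by
  refine ⟨?_, ?_, ?_⟩
  · rintro ⟨u, x, y⟩ ⟨hu, -⟩
    obtain ⟨a, b, g, rfl⟩ := unitri_eq hu
    simp only [pair_formula, Set.mem_ofPred_eq]
    refine ⟨?_, ?_, ⟨x * y, ?_⟩, ?_, ?_⟩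
    · ext i j
      fin_cases i <;> fin_cases j <;> simp
    · ext i j
      fin_cases i <;> fin_cases j <;> simp
    · ext i j
      fin_cases i <;> fin_cases j <;> simp [Matrix.mul_apply, Fin.sum_univ_three] <;> ring
    · simp
    · simp
  · rintro ⟨u, x, y⟩ ⟨hu, -⟩ ⟨u', x', y'⟩ ⟨hu', -⟩ h
    obtain ⟨a, b, g, rfl⟩ := unitri_eq hu
    obtain ⟨a', b', g', rfl⟩ := unitri_eq hu'
    simp only [pair_formula, Prod.mk.injEq] at h
    obtain ⟨h, h'⟩ := h
    have e1 : a = a' := by simpa using congrFun (congrFun h 0) 1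
    have e2 : b = b' := by simpa using congrFun (congrFun h' 0) 2
    have e3 : g = g' := by simpa using congrFun (congrFun h' 1) 2
    subst e1 e2 e3
    have e4 : x = x' := by simpa using congrFun (congrFun h 1) 1
    have e5 : y = y' := by simpa using congrFun (congrFun h' 1) 1
    subst e4 e5
    rfl
  · rintro ⟨S, T⟩ ⟨hS, hT, ⟨c, hc⟩, h1, h2⟩
    simp only at hS hT hc h1 h2
    have s10 := hS.apply 0 1
    have s20 := hS.apply 0 2
    have s21 := hS.apply 1 2
    have t10 := hT.apply 0 1
    have t20 := hT.apply 0 2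
    have t21 := hT.apply 1 2
    have c00 := congrFun (congrFun hc 0) 0
    have c01 := congrFun (congrFun hc 0) 1
    have c02 := congrFun (congrFun hc 0) 2
    have c11 := congrFun (congrFun hc 1) 1
    have c12 := congrFun (congrFun hc 1) 2
    have c22 := congrFun (congrFun hc 2) 2
    simp [Matrix.mul_apply, Fin.sum_univ_three, h1, h2, s10, s20, s21, t10, t20, t21]
      at c00 c01 c02 c11 c12 c22
    refine ⟨(!![1, -S 0 1, T 0 2; 0, 1, T 1 2; 0, 0, 1], S 1 1 - S 0 1 ^ 2, T 1 1 - T 1 2 ^ 2),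
      ⟨by simp [UpperUnitri], trivial⟩, ?_⟩
    simp only [pair_formula]
    have eb : S 0 2 = -T 0 2 - S 0 1 * T 1 2 := by linear_combination c02
    have ee : S 1 2 = -(S 0 1 * T 0 2) - S 1 1 * T 1 2 := by linear_combination c12
    rw [eb] at c00 c01 c22
    rw [ee] at c11 c22
    have eq : T 0 1 = -(S 0 1 * T 1 1) + (T 0 2 + S 0 1 * T 1 2) * T 1 2 := by
      linear_combination c01
    rw [eq] at c00 c11
    refine Prod.ext ?_ ?_
    · ext i j
      fin_cases i <;> fin_cases j <;> simp [h1, s10, s20, s21, eb, ee] <;>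
        first | ring1 | linear_combination c11 - c22
    · ext i j
      fin_cases i <;> fin_cases j <;> simp [h2, t10, t20, t21, eq] <;>
        first | ring1 | linear_combination c11 - c00
end

section
/- Let k be a field, u an upper unitriangular 3×3 matrix over k, u' a lower unitriangular 3×3 matrix over k, and a₁, a₂ ∈ k. Set g := u·diag(a₁a₂, a₂, 1)·u' and g' := ᵀ(u⁻¹)·diag(1, a₁, a₁a₂)·ᵀ(u'⁻¹). Then g·ᵀg' = a₁a₂·I₃, ᵀg'·g = a₁a₂·I₃, adj(g) = a₂·ᵀg', adj(g') = a₁·ᵀg, g₃₃ = 1, and g'₁₁ = 1. -/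
open Matrix

/-- Parametrization of the big cell `(Ḡ)₀` of the wonderful compactification of `PGL₃`:
for `u` upper unitriangular, `u'` lower unitriangular and `a₁, a₂ ∈ k`, the pair
`g := u·diag(a₁a₂,a₂,1)·u'`, `g' := ᵀ(u⁻¹)·diag(1,a₁,a₁a₂)·ᵀ(u'⁻¹)` satisfies
`g·ᵀg' = a₁a₂·I₃`, `ᵀg'·g = a₁a₂·I₃`, `adj(g) = a₂·ᵀg'`, `adj(g') = a₁·ᵀg`,
`g₃₃ = 1` and `g'₁₁ = 1`. -/
theorem stmt_16 {k : Type*} [Field k] (u₁₂ u₁₃ u₂₃ u'₂₁ u'₃₁ u'₃₂ a₁ a₂ : k)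
    (u u' g g' : Matrix (Fin 3) (Fin 3) k)
    (hu : u = !![1, u₁₂, u₁₃; 0, 1, u₂₃; 0, 0, 1])
    (hu' : u' = !![1, 0, 0; u'₂₁, 1, 0; u'₃₁, u'₃₂, 1])
    (hg : g = u * diagonal ![a₁ * a₂, a₂, 1] * u')
    (hg' : g' = (u⁻¹)ᵀ * diagonal ![1, a₁, a₁ * a₂] * (u'⁻¹)ᵀ) :
    g * g'ᵀ = (a₁ * a₂) • (1 : Matrix (Fin 3) (Fin 3) k) ∧
    g'ᵀ * g = (a₁ * a₂) • (1 : Matrix (Fin 3) (Fin 3) k) ∧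
    g.adjugate = a₂ • g'ᵀ ∧ g'.adjugate = a₁ • gᵀ ∧
    g 2 2 = 1 ∧ g' 0 0 = 1 := by
  have h1 : u⁻¹ = !![1, -u₁₂, u₁₂ * u₂₃ - u₁₃; 0, 1, -u₂₃; 0, 0, 1] := by
    apply Matrix.inv_eq_right_inv
    subst hu
    ext i j
    fin_cases i <;> fin_cases j <;> simp [Matrix.mul_apply, Fin.sum_univ_three] <;> ring
  have h2 : u'⁻¹ = !![1, 0, 0; -u'₂₁, 1, 0; u'₂₁ * u'₃₂ - u'₃₁, -u'₃₂, 1] := by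
    apply Matrix.inv_eq_right_inv
    subst hu'
    ext i j
    fin_cases i <;> fin_cases j <;> simp [Matrix.mul_apply, Fin.sum_univ_three] <;> ring
  have e : g = !![a₁ * a₂ + u₁₂ * a₂ * u'₂₁ + u₁₃ * u'₃₁, u₁₂ * a₂ + u₁₃ * u'₃₂, u₁₃;
      a₂ * u'₂₁ + u₂₃ * u'₃₁, a₂ + u₂₃ * u'₃₂, u₂₃; u'₃₁, u'₃₂, 1] := by
    rw [hg, hu, hu']
    ext i j
    fin_cases i <;> fin_cases j <;>
      simp [Matrix.mul_apply, Fin.sum_univ_three, Matrix.vecMul_diagonal]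
  have e' : g' = !![1, -u'₂₁, u'₂₁ * u'₃₂ - u'₃₁;
      -u₁₂, u₁₂ * u'₂₁ + a₁, -u₁₂ * (u'₂₁ * u'₃₂ - u'₃₁) - a₁ * u'₃₂;
      u₁₂ * u₂₃ - u₁₃, -(u₁₂ * u₂₃ - u₁₃) * u'₂₁ - u₂₃ * a₁,
      (u₁₂ * u₂₃ - u₁₃) * (u'₂₁ * u'₃₂ - u'₃₁) + u₂₃ * a₁ * u'₃₂ + a₁ * a₂] := by
    rw [hg', h1, h2]
    ext i j
    fin_cases i <;> fin_cases j <;>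
      simp [Matrix.mul_apply, Fin.sum_univ_three, Matrix.vecMul_diagonal] <;> ring
  clear hg hg' h1 h2
  subst e e'
  refine ⟨?_, ?_, ?_, ?_, by simp, by simp⟩
  · ext i j
    fin_cases i <;> fin_cases j <;> simp [Matrix.mul_apply, Fin.sum_univ_three] <;> ring
  · ext i j
    fin_cases i <;> fin_cases j <;> simp [Matrix.mul_apply, Fin.sum_univ_three] <;> ring
  · rw [Matrix.adjugate_fin_three]
    ext i j
    fin_cases i <;> fin_cases j <;> simp <;> ring
  · rw [Matrix.adjugate_fin_three]
    ext i j
    fin_cases i <;> fin_cases j <;> simp <;> ring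
end

section
/- Let k be an algebraically closed field of characteristic zero. The map sending (u, a₁, a₂, u'), where u ranges over upper unitriangular 3×3 matrices over k, u' over lower unitriangular 3×3 matrices over k, and a₁, a₂ ∈ k, to the pair (g, g') := (u·diag(a₁a₂, a₂, 1)·u', ᵀ(u⁻¹)·diag(1, a₁, a₁a₂)·ᵀ(u'⁻¹)), is a bijection from U × k² × U⁻ onto the set of pairs (g, g') of 3×3 matrices over k such that g·ᵀg' is a scalar multiple of I₃, ᵀg'·g is a scalar multiple of I₃, g₃₃ = 1, and g'₁₁ = 1. -/
open Matrix

/-- The set of lower unitriangular `3 × 3` matrices over `k`. -/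
def LowerUnitri (k : Type*) [Field k] : Set (Matrix (Fin 3) (Fin 3) k) :=
  {u | u 0 0 = 1 ∧ u 1 1 = 1 ∧ u 2 2 = 1 ∧ u 0 1 = 0 ∧ u 0 2 = 0 ∧ u 1 2 = 0}

def upM {k : Type*} [Field k] (x y z : k) : Matrix (Fin 3) (Fin 3) k :=
  !![1, x, y; 0, 1, z; 0, 0, 1]

def loM {k : Type*} [Field k] (x y z : k) : Matrix (Fin 3) (Fin 3) k :=
  !![1, 0, 0; x, 1, 0; y, z, 1]

lemma upM_mul {k : Type*} [Field k] (x y z : k) : upM x y z * upM (-x) (x*z-y) (-z) = 1 := by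
  ext i j
  fin_cases i <;> fin_cases j <;> simp [upM, Matrix.mul_apply, Fin.sum_univ_three] <;> ring

lemma loM_mul {k : Type*} [Field k] (x y z : k) : loM x y z * loM (-x) (x*z-y) (-z) = 1 := by
  ext i j
  fin_cases i <;> fin_cases j <;> simp [loM, Matrix.mul_apply, Fin.sum_univ_three] <;> ring

lemma upM_inv {k : Type*} [Field k] (x y z : k) :
    (upM x y z)⁻¹ = upM (-x) (x*z-y) (-z) := Matrix.inv_eq_right_inv (upM_mul x y z)

lemma loM_inv {k : Type*} [Field k] (x y z : k) :
    (loM x y z)⁻¹ = loM (-x) (x*z-y) (-z) := Matrix.inv_eq_right_inv (loM_mul x y z)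

lemma upM_mem {k : Type*} [Field k] (x y z : k) : upM x y z ∈ UpperUnitri k := by
  simp [UpperUnitri, upM]

lemma loM_mem {k : Type*} [Field k] (x y z : k) : loM x y z ∈ LowerUnitri k := by
  simp [LowerUnitri, loM]

lemma upM_of {k : Type*} [Field k] {u : Matrix (Fin 3) (Fin 3) k} (h : u ∈ UpperUnitri k) :
    ∃ x y z, u = upM x y z := by
  obtain ⟨h1, h2, h3, h4, h5, h6⟩ := h
  refine ⟨u 0 1, u 0 2, u 1 2, ?_⟩
  ext i j
  fin_cases i <;> fin_cases j <;> simp [upM, *]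

lemma loM_of {k : Type*} [Field k] {u : Matrix (Fin 3) (Fin 3) k} (h : u ∈ LowerUnitri k) :
    ∃ x y z, u = loM x y z := by
  obtain ⟨h1, h2, h3, h4, h5, h6⟩ := h
  refine ⟨u 1 0, u 2 0, u 2 1, ?_⟩
  ext i j
  fin_cases i <;> fin_cases j <;> simp [loM, *]

lemma fst_eq {k : Type*} [Field k] (x y z a b x' y' z' : k) :
    upM x y z * diagonal ![a * b, b, 1] * loM x' y' z' =
    !![a*b + x*b*x' + y*y', x*b + y*z', y; b*x' + z*y', b+z*z', z; y', z', 1] := by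
  ext i j
  fin_cases i <;> fin_cases j <;> (simp only [Matrix.mul_apply, Fin.sum_univ_three, Matrix.transpose_apply]; simp [upM, loM, Matrix.diagonal_apply])

lemma snd_eq {k : Type*} [Field k] (x y z a b x' y' z' : k) :
    ((upM x y z)⁻¹)ᵀ * diagonal ![1, a, a * b] * ((loM x' y' z')⁻¹)ᵀ =
    !![1, -x', x'*z'-y'; -x, x*x'+a, -x*(x'*z'-y')-a*z';
      x*z-y, -(x*z-y)*x'-z*a, (x*z-y)*(x'*z'-y')+z*a*z'+a*b] := by
  rw [upM_inv, loM_inv]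
  ext i j
  fin_cases i <;> fin_cases j <;>
    (simp only [Matrix.mul_apply, Fin.sum_univ_three, Matrix.transpose_apply]; simp [upM, loM, Matrix.diagonal_apply]; try ring)

lemma normal_form {k : Type*} [Field k] (P Q : Matrix (Fin 3) (Fin 3) k) (c d : k)
    (h1 : P * Qᵀ = c • (1 : Matrix (Fin 3) (Fin 3) k))
    (h2 : Qᵀ * P = d • (1 : Matrix (Fin 3) (Fin 3) k))
    (p22 : P 2 2 = 1) (q00 : Q 0 0 = 1) (p02 : P 0 2 = 0) (p12 : P 1 2 = 0)
    (p20 : P 2 0 = 0) (p21 : P 2 1 = 0) (q01 : Q 0 1 = 0) (q10 : Q 1 0 = 0) :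
    P = diagonal ![Q 1 1 * P 1 1, P 1 1, 1] ∧ Q = diagonal ![1, Q 1 1, Q 1 1 * P 1 1] := by
  have e1 := fun i j => congrFun (congrFun h1 i) j
  have e2 := fun i j => congrFun (congrFun h2 i) j
  simp only [Matrix.mul_apply, Fin.sum_univ_three, Matrix.transpose_apply,
    Matrix.smul_apply, smul_eq_mul] at e1 e2
  have a20 := e1 2 0
  have a21 := e1 2 1
  have a22 := e1 2 2
  have a10 := e1 1 0
  have a11 := e1 1 1
  have a00 := e1 0 0
  have b01 := e2 0 1
  have b02 := e2 0 2
  have b12 := e2 1 2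
  simp [p22, q00, p02, p12, p20, p21, q01, q10] at a20 a21 a22 a10 a11 a00 b01 b02 b12
  constructor <;> ext i j <;> fin_cases i <;> fin_cases j <;> simp [Matrix.diagonal_apply] <;> grind

/-- The map `(u, a₁, a₂, u') ↦ (g, g') := (u·diag(a₁a₂,a₂,1)·u',
ᵀ(u⁻¹)·diag(1,a₁,a₁a₂)·ᵀ(u'⁻¹))` is a bijection from `U × k² × U⁻` onto the set of pairs
`(g, g')` of `3 × 3` matrices with `g·ᵀg'` and `ᵀg'·g` scalar multiples of `I₃`, `g₃₃ = 1`
and `g'₁₁ = 1` (the big cell of the wonderful compactification of `PGL₃`). -/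
theorem stmt_17 {k : Type*} [Field k] [IsAlgClosed k] [CharZero k] :
    Set.BijOn
      (fun t : Matrix (Fin 3) (Fin 3) k × (k × k) × Matrix (Fin 3) (Fin 3) k =>
        ((t.1 * diagonal ![t.2.1.1 * t.2.1.2, t.2.1.2, 1] * t.2.2,
          (t.1⁻¹)ᵀ * diagonal ![1, t.2.1.1, t.2.1.1 * t.2.1.2] * (t.2.2⁻¹)ᵀ) :
          Matrix (Fin 3) (Fin 3) k × Matrix (Fin 3) (Fin 3) k))
      (UpperUnitri k ×ˢ (Set.univ : Set (k × k)) ×ˢ LowerUnitri k)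
      {p : Matrix (Fin 3) (Fin 3) k × Matrix (Fin 3) (Fin 3) k |
        (∃ c : k, p.1 * p.2ᵀ = c • (1 : Matrix (Fin 3) (Fin 3) k)) ∧
        (∃ c : k, p.2ᵀ * p.1 = c • (1 : Matrix (Fin 3) (Fin 3) k)) ∧
        p.1 2 2 = 1 ∧ p.2 0 0 = 1} := by
  refine ⟨?_, ?_, ?_⟩
  · rintro ⟨u, ⟨a, b⟩, v⟩ ⟨hu, -, hv⟩
    obtain ⟨x, y, z, rfl⟩ := upM_of hu
    obtain ⟨x', y', z', rfl⟩ := loM_of hv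
    simp only [fst_eq, snd_eq, Set.mem_ofPred_eq]
    refine ⟨⟨a * b, ?_⟩, ⟨a * b, ?_⟩, by simp, by simp⟩ <;> ext i j <;>
      fin_cases i <;> fin_cases j <;>
      simp [Matrix.mul_apply, Fin.sum_univ_three] <;> ring
  · rintro ⟨u, ⟨a, b⟩, v⟩ ⟨hu, -, hv⟩ ⟨u1, ⟨a1, b1⟩, v1⟩ ⟨hu1, -, hv1⟩ h
    obtain ⟨x, y, z, rfl⟩ := upM_of hu
    obtain ⟨x', y', z', rfl⟩ := loM_of hv
    obtain ⟨r, s, t, rfl⟩ := upM_of hu1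
    obtain ⟨r', s', t', rfl⟩ := loM_of hv1
    simp only [fst_eq, snd_eq, Prod.mk.injEq] at h
    obtain ⟨h1, h2⟩ := h
    have e1 := fun i j => congrFun (congrFun h1 i) j
    have e2 := fun i j => congrFun (congrFun h2 i) j
    have hy : y = s := by simpa using e1 0 2
    have hz : z = t := by simpa using e1 1 2
    have hy' : y' = s' := by simpa using e1 2 0
    have hz' : z' = t' := by simpa using e1 2 1
    have hx : x = r := by simpa using e2 1 0
    have hx' : x' = r' := by simpa using e2 0 1
    subst hy hz hy' hz' hx hx'
    have hb : b = b1 := by simpa using e1 1 1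
    have ha : a = a1 := by simpa using e2 1 1
    rw [ha, hb]
  · rintro ⟨g, g'⟩ ⟨⟨c, hc⟩, ⟨d, hd⟩, h1, h2⟩
    simp only at hc hd h1 h2
    obtain ⟨u, hu⟩ : ∃ u, u = upM (-g' 1 0) (g 0 2) (g 1 2) := ⟨_, rfl⟩
    obtain ⟨v, hv⟩ : ∃ v, v = loM (-g' 0 1) (g 2 0) (g 2 1) := ⟨_, rfl⟩
    have hui : u⁻¹ = upM (g' 1 0) (-g' 1 0 * g 1 2 - g 0 2) (-g 1 2) := by
      rw [hu, upM_inv, neg_neg]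
    have hvi : v⁻¹ = loM (g' 0 1) (-g' 0 1 * g 2 1 - g 2 0) (-g 2 1) := by
      rw [hv, loM_inv, neg_neg]
    have uu : u * u⁻¹ = 1 := by rw [hu, upM_inv, upM_mul]
    have vv : v * v⁻¹ = 1 := by rw [hv, loM_inv, loM_mul]
    have uu' : u⁻¹ * u = 1 := mul_eq_one_comm.mp uu
    have vv' : v⁻¹ * v = 1 := mul_eq_one_comm.mp vv
    obtain ⟨P, hP⟩ : ∃ P, P = u⁻¹ * g * v⁻¹ := ⟨_, rfl⟩
    obtain ⟨Q, hQ⟩ : ∃ Q, Q = uᵀ * g' * vᵀ := ⟨_, rfl⟩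
    have hPQ : P * Qᵀ = c • (1 : Matrix (Fin 3) (Fin 3) k) := by
      calc P * Qᵀ = u⁻¹ * (g * ((v⁻¹ * v) * g'ᵀ)) * u := by
            rw [hP, hQ]; simp only [transpose_mul, transpose_transpose, Matrix.mul_assoc]
        _ = _ := by rw [vv', Matrix.one_mul, hc]; simp [uu']
    have hQP : Qᵀ * P = d • (1 : Matrix (Fin 3) (Fin 3) k) := by
      calc Qᵀ * P = v * (g'ᵀ * ((u * u⁻¹) * g)) * v⁻¹ := by
            rw [hP, hQ]; simp only [transpose_mul, transpose_transpose, Matrix.mul_assoc]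
        _ = _ := by rw [uu, Matrix.one_mul, hd]; simp [vv]
    have hg : g = u * P * v := by
      calc g = (u * u⁻¹) * g * (v⁻¹ * v) := by rw [uu, vv']; simp
        _ = _ := by rw [hP]; simp only [Matrix.mul_assoc]
    have hg' : g' = (u⁻¹)ᵀ * Q * (v⁻¹)ᵀ := by
      calc g' = (u * u⁻¹)ᵀ * g' * (v⁻¹ * v)ᵀ := by rw [uu, vv']; simp
        _ = _ := by rw [hQ]; simp only [transpose_mul, Matrix.mul_assoc]
    obtain ⟨n1, n2⟩ := normal_form P Q c d hPQ hQP
      (by rw [hP, hui, hvi]; simp only [Matrix.mul_apply, Fin.sum_univ_three, Matrix.transpose_apply]; simp [upM, loM, h1])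
      (by rw [hQ, hu, hv]; simp only [Matrix.mul_apply, Fin.sum_univ_three, Matrix.transpose_apply]; simp [upM, loM, h2])
      (by rw [hP, hui, hvi]; simp only [Matrix.mul_apply, Fin.sum_univ_three, Matrix.transpose_apply]; simp [upM, loM, h1]; try ring)
      (by rw [hP, hui, hvi]; simp only [Matrix.mul_apply, Fin.sum_univ_three, Matrix.transpose_apply]; simp [upM, loM, h1])
      (by rw [hP, hui, hvi]; simp only [Matrix.mul_apply, Fin.sum_univ_three, Matrix.transpose_apply]; simp [upM, loM, h1]; try ring)
      (by rw [hP, hui, hvi]; simp only [Matrix.mul_apply, Fin.sum_univ_three, Matrix.transpose_apply]; simp [upM, loM, h1])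
      (by rw [hQ, hu, hv]; simp only [Matrix.mul_apply, Fin.sum_univ_three, Matrix.transpose_apply]; simp [upM, loM, h2])
      (by rw [hQ, hu, hv]; simp only [Matrix.mul_apply, Fin.sum_univ_three, Matrix.transpose_apply]; simp [upM, loM, h2])
    refine ⟨(u, (Q 1 1, P 1 1), v), ⟨hu ▸ upM_mem _ _ _, trivial, hv ▸ loM_mem _ _ _⟩, ?_⟩
    simp only [Prod.mk.injEq]
    rw [← n1, ← n2]
    exact ⟨hg.symm, hg'.symm⟩
end
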